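/- Let μ = (μ_1,...,μ_n) ∈ ℝ^n with μ_1 ≤ μ_2 ≤ ... ≤ μ_n lying in the Garding cone Γ_k (i.e. σ_j(μ) > 0 for all 1 ≤ j ≤ k), and 0 ≤ l ≤ k-2, k ≥ 2. Define G^{ii} = ∂/∂μ_i (σ_k/σ_l)^{1/(k-l)}(μ). Then G^{11} ≥ G^{22} ≥ ... ≥ G^{nn} ≥ 0. -/

import Mathlib

open Finset

/-- The `m`-th elementary symmetric polynomial of `μ : Fin n → ℝ`. -/
noncomputable def esymm (n m : ℕ) (μ : Fin n → ℝ) : ℝ :=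
  ∑ s ∈ Finset.powersetCard m (Finset.univ : Finset (Fin n)), ∏ i ∈ s, μ i

/-- The Hessian quotient operator `G(μ) = (σ_k(μ)/σ_l(μ))^{1/(k-l)}`. -/
noncomputable def Gq (n k l : ℕ) (μ : Fin n → ℝ) : ℝ :=
  (esymm n k μ / esymm n l μ) ^ ((((k : ℝ) - l))⁻¹)

/-- `G^{ii} = ∂G/∂μ_i`. -/
noncomputable def Gii (n k l : ℕ) (μ : Fin n → ℝ) (i : Fin n) : ℝ :=
  fderiv ℝ (Gq n k l) μ (Pi.single i 1)

/-- The `m`-th elementary symmetric polynomial in the entries of `μ` indexed by `s`. -/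
noncomputable def esymmOn {ι : Type*} (μ : ι → ℝ) (s : Finset ι) (m : ℕ) : ℝ :=
  ∑ t ∈ Finset.powersetCard m s, ∏ i ∈ t, μ i

/-- If `i ∉ s`, this is the derivative of `esymmOn μ (insert i s) m` in `μ i`. -/
noncomputable def esymmOnDeriv {ι : Type*} (μ : ι → ℝ) (s : Finset ι) : ℕ → ℝ
  | 0 => 0
  | m + 1 => esymmOn μ s m

section Newton

open Polynomial

theorem splits_derivative_of_real {p : ℝ[X]} (hp : p.Splits) : p.derivative.Splits := by
  rw [splits_iff_card_roots] at hp ⊢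
  have h1 := card_roots_le_derivative p
  have h2 := natDegree_derivative_le p
  have h3 := card_roots' (derivative p)
  omega

theorem splits_iterate_derivative_of_real {p : ℝ[X]} (hp : p.Splits) (j : ℕ) :
    (derivative^[j] p).Splits := by
  induction j with
  | zero => exact hp
  | succ j ih =>
    rw [Function.iterate_succ_apply']
    exact splits_derivative_of_real ih

theorem coeff_mul_coeff_le_sq_of_splits {p : ℝ[X]} (hp : p.Splits) :
    2 * (p.coeff 0 * p.coeff 2) ≤ p.coeff 1 ^ 2 := by
  have key : ∀ s : Multiset ℝ, 2 * (((s.map fun a => X - C a).prod).coeff 0 *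
      ((s.map fun a => X - C a).prod).coeff 2) ≤ ((s.map fun a => X - C a).prod).coeff 1 ^ 2 := by
    intro s
    induction s using Multiset.induction_on with
    | empty => simp [coeff_one]
    | cons r s ih =>
      simp only [Multiset.map_cons, Multiset.prod_cons, sub_mul, coeff_sub, coeff_C_mul,
        coeff_X_mul, mul_coeff_zero, coeff_X_zero, zero_mul]
      set q := (s.map fun a => X - C a).prod
      simp only [coeff_C_zero]
      nlinarith [mul_le_mul_of_nonneg_left ih (sq_nonneg r), sq_nonneg (q.coeff 0)]
  rw [hp.eq_prod_roots]
  simp only [coeff_C_mul]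
  nlinarith [mul_le_mul_of_nonneg_left (key p.roots) (sq_nonneg p.leadingCoeff)]

theorem coeff_mul_coeff_add_two_le_sq_of_splits {p : ℝ[X]} (hp : p.Splits) (j : ℕ) :
    p.coeff j * p.coeff (j + 2) ≤ p.coeff (j + 1) ^ 2 := by
  have h := coeff_mul_coeff_le_sq_of_splits (splits_iterate_derivative_of_real hp j)
  simp only [coeff_iterate_derivative, nsmul_eq_mul, zero_add] at h
  rw [Nat.descFactorial_self, add_comm 1 j, add_comm 2 j] at h
  have e1 : (j + 1).descFactorial j = (j + 1) * j.factorial := by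
    have := Nat.factorial_mul_descFactorial (n := j + 1) (k := j) (by omega)
    simpa [Nat.factorial_succ] using this
  have e2 : 2 * (j + 2).descFactorial j = (j + 2) * (j + 1) * j.factorial := by
    have := Nat.factorial_mul_descFactorial (n := j + 2) (k := j) (by omega)
    simpa [Nat.factorial_succ, mul_assoc] using this
  have e2' : 2 * ((j + 2).descFactorial j : ℝ) = (j + 2) * (j + 1) * j.factorial := by
    exact_mod_cast e2
  rw [e1] at h
  push_cast at h
  have hf : (0 : ℝ) < j.factorial := by positivity
  set f : ℝ := (j.factorial : ℝ)
  have h' : (f ^ 2 * (j + 1)) * ((j + 2) * (p.coeff j * p.coeff (j + 2)))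
      ≤ (f ^ 2 * (j + 1)) * ((j + 1) * p.coeff (j + 1) ^ 2) := by
    calc _ = f * p.coeff j * ((j + 2) * (j + 1) * f * p.coeff (j + 2)) := by ring
      _ = _ := by rw [← e2']
      _ = 2 * (f * p.coeff j * (((j + 2).descFactorial j : ℝ) * p.coeff (j + 2))) := by ring
      _ ≤ _ := h
      _ = _ := by ring
  have h'' := le_of_mul_le_mul_left h' (by positivity)
  rcases le_or_gt (p.coeff j * p.coeff (j + 2)) 0 with hn | hn
  · exact hn.trans (sq_nonneg _)
  · have hj : (0 : ℝ) < j + 1 := by positivity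
    refine le_of_mul_le_mul_left ?_ hj
    nlinarith

/-- **Newton's inequality** (with constant one) for elementary symmetric polynomials. -/
theorem esymmOn_mul_esymmOn_le_sq {ι : Type*} (μ : ι → ℝ) (s : Finset ι) (m : ℕ) :
    esymmOn μ s m * esymmOn μ s (m + 2) ≤ esymmOn μ s (m + 1) ^ 2 := by
  rcases le_or_gt (m + 2) #s with h | h
  · have hs : (∏ i ∈ s, (X + C (μ i))).Splits := Splits.prod fun i _ => Splits.X_add_C _
    have := coeff_mul_coeff_add_two_le_sq_of_splits hs (#s - (m + 2))
    rw [prod_X_add_C_coeff _ _ (by omega), prod_X_add_C_coeff _ _ (by omega),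
      prod_X_add_C_coeff _ _ (by omega), show #s - (#s - (m + 2)) = m + 2 by omega,
      show #s - (#s - (m + 2) + 2) = m by omega,
      show #s - (#s - (m + 2) + 1) = m + 1 by omega] at this
    rw [mul_comm]
    exact this
  · have : esymmOn μ s (m + 2) = 0 := by
      rw [esymmOn, powersetCard_eq_empty.2 h, sum_empty]
    rw [this, mul_zero]
    exact sq_nonneg _

end Newton

section Cone

variable {ι : Type*} {μ : ι → ℝ} {s : Finset ι} {i j : ι} {k l m : ℕ}

@[simp]
theorem esymmOn_zero : esymmOn μ s 0 = 1 := by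
  simp [esymmOn]

theorem esymmOn_insert_succ [DecidableEq ι] (hi : i ∉ s) (m : ℕ) :
    esymmOn μ (insert i s) (m + 1) = esymmOn μ s (m + 1) + μ i * esymmOn μ s m := by
  unfold esymmOn
  rw [powersetCard_succ_insert hi, sum_union, sum_image, mul_sum]
  · congr 1
    refine sum_congr rfl fun t ht => ?_
    rw [prod_insert fun h => hi ((mem_powersetCard.1 ht).1 h)]
  · intro t ht u hu h
    rw [← erase_insert fun h => hi ((mem_powersetCard.1 ht).1 h),
      ← erase_insert fun h => hi ((mem_powersetCard.1 hu).1 h)]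
    exact congrArg (fun v => v.erase i) h
  · refine disjoint_left.2 fun t ht hu => ?_
    obtain ⟨u, -, rfl⟩ := mem_image.1 hu
    exact hi ((mem_powersetCard.1 ht).1 (mem_insert_self _ _))

theorem esymmOn_insert [DecidableEq ι] (hi : i ∉ s) (m : ℕ) :
    esymmOn μ (insert i s) m = esymmOn μ s m + μ i * esymmOnDeriv μ s m := by
  cases m with
  | zero => simp [esymmOnDeriv]
  | succ m => exact esymmOn_insert_succ hi m

/-- Omitting an entry maps the Garding cone `Γ_k` into `Γ_{k-1}`. -/
theorem esymmOn_pos_of_insert [DecidableEq ι] (hi : i ∉ s)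
    (h : ∀ m ≤ k, 0 < esymmOn μ (insert i s) m) (hm : m < k) : 0 < esymmOn μ s m := by
  induction m with
  | zero => simp
  | succ m ih =>
    have h0 := ih (by omega)
    have h1 := h (m + 1) (by omega)
    have h2 := h (m + 2) (by omega)
    rw [esymmOn_insert_succ hi] at h1 h2
    have hN := esymmOn_mul_esymmOn_le_sq μ s m
    by_contra! hneg
    nlinarith [mul_pos h0 h2, mul_nonneg (neg_nonneg.2 hneg) h1.le]

theorem esymmOn_succ_mul_le (h : ∀ m ≤ k, 0 < esymmOn μ s m) (hl : l ≤ k) :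
    esymmOn μ s (k + 1) * esymmOn μ s l ≤ esymmOn μ s k * esymmOn μ s (l + 1) := by
  induction k, hl using Nat.le_induction with
  | base => rw [mul_comm]
  | succ k hlk ih =>
    have ih := ih fun m hm => h m (by omega)
    have hN := esymmOn_mul_esymmOn_le_sq μ s k
    have h0 := h k (by omega)
    have h1 := h (k + 1) le_rfl
    have h2 := h l (by omega)
    refine le_of_mul_le_mul_left ?_ h0
    nlinarith [mul_le_mul_of_nonneg_left hN h2.le, mul_le_mul_of_nonneg_left ih h1.le]

theorem esymmOn_insert_succ_mul_le [DecidableEq ι] (hi : i ∉ s)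
    (h : ∀ m ≤ k + 1, 0 < esymmOn μ (insert i s) m) (hl : l ≤ k) :
    esymmOn μ (insert i s) (k + 1) * esymmOn μ s l ≤
      esymmOn μ s k * esymmOn μ (insert i s) (l + 1) := by
  have := esymmOn_succ_mul_le (μ := μ) (s := s) (k := k) (l := l)
    (fun m hm => esymmOn_pos_of_insert hi h (by omega)) hl
  rw [esymmOn_insert_succ hi, esymmOn_insert_succ hi]
  linarith

theorem esymmOn_insert_insert_mul_le [DecidableEq ι] (hj : j ∉ s) (hi : i ∉ insert j s)
    (h : ∀ m ≤ k + 2, 0 < esymmOn μ (insert i (insert j s)) m) (hl : l ≤ k) :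
    esymmOn μ (insert i (insert j s)) (k + 2) * esymmOn μ s l ≤
      esymmOn μ s k * esymmOn μ (insert i (insert j s)) (l + 2) := by
  have hpos : ∀ m ≤ k + 1, 0 < esymmOn μ (insert j s) m :=
    fun m hm => esymmOn_pos_of_insert hi h (by omega)
  have h1 := esymmOn_insert_succ_mul_le hi h (show l + 1 ≤ k + 1 by omega)
  have h2 := esymmOn_insert_succ_mul_le hj hpos hl
  have h3 : 0 < esymmOn μ s l := esymmOn_pos_of_insert hj hpos (by omega)
  refine le_of_mul_le_mul_left ?_ (hpos (l + 1) (by omega))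
  nlinarith [mul_le_mul_of_nonneg_left h1 h3.le,
    mul_le_mul_of_nonneg_left h2 (h (l + 2) (by omega)).le]

theorem esymmOnDeriv_quotient_nonneg [DecidableEq ι] (hi : i ∉ s)
    (h : ∀ m ≤ k, 0 < esymmOn μ (insert i s) m) (hl : l < k) :
    0 ≤ esymmOnDeriv μ s k * esymmOn μ (insert i s) l -
      esymmOn μ (insert i s) k * esymmOnDeriv μ s l := by
  obtain ⟨k, rfl⟩ : ∃ k', k = k' + 1 := ⟨k - 1, by omega⟩
  cases l with
  | zero =>
    simpa [esymmOnDeriv] using (esymmOn_pos_of_insert hi h (Nat.lt_succ_self k)).le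
  | succ l => exact sub_nonneg.2 (esymmOn_insert_succ_mul_le hi h (by omega))

theorem esymmOnDeriv_quotient_le [DecidableEq ι] (hij : i ≠ j) (hi : i ∉ s) (hj : j ∉ s)
    (h : ∀ m ≤ k, 0 < esymmOn μ (insert i (insert j s)) m) (hl : l + 2 ≤ k) (hμ : μ i ≤ μ j) :
    esymmOnDeriv μ (insert i s) k * esymmOn μ (insert i (insert j s)) l -
        esymmOn μ (insert i (insert j s)) k * esymmOnDeriv μ (insert i s) l ≤
      esymmOnDeriv μ (insert j s) k * esymmOn μ (insert i (insert j s)) l -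
        esymmOn μ (insert i (insert j s)) k * esymmOnDeriv μ (insert j s) l := by
  obtain ⟨k, rfl⟩ : ∃ k', k = k' + 2 := ⟨k - 2, by omega⟩
  have hi' : i ∉ insert j s := by simp [hij, hi]
  have hk : 0 < esymmOn μ s k := esymmOn_pos_of_insert (k := k + 1) hj
    (fun m hm => esymmOn_pos_of_insert hi' h (by omega)) (by omega)
  rcases l with _ | _ | l
  · simp only [esymmOnDeriv, esymmOn_insert_succ hi, esymmOn_insert_succ hj, esymmOn_zero]
    nlinarith
  · have hT := h 1 (by omega)
    simp only [esymmOnDeriv, zero_add, esymmOn_zero, esymmOn_insert_succ hi k,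
      esymmOn_insert_succ hj k]
    nlinarith [mul_nonneg (mul_nonneg (sub_nonneg.2 hμ) hk.le) hT.le]
  · have key := esymmOn_insert_insert_mul_le hj hi' h (show l ≤ k by omega)
    generalize esymmOn μ (insert i (insert j s)) (k + 2) = A at *
    generalize esymmOn μ (insert i (insert j s)) (l + 2) = B at *
    simp only [esymmOnDeriv, esymmOn_insert_succ hi, esymmOn_insert_succ hj]
    nlinarith [mul_nonneg (sub_nonneg.2 hμ) (sub_nonneg.2 key)]

end Cone

section Derivative

variable {n : ℕ}

theorem esymmOn_univ (m : ℕ) (μ : Fin n → ℝ) : esymmOn μ univ m = esymm n m μ := rfl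

theorem differentiable_esymm (m : ℕ) : Differentiable ℝ (esymm n m) := by
  unfold esymm
  fun_prop

theorem esymm_add_smul_single (m : ℕ) (μ : Fin n → ℝ) (i : Fin n) (t : ℝ) :
    esymm n m (μ + t • Pi.single i 1) =
      esymm n m μ + t * esymmOnDeriv μ (univ.erase i) m := by
  have hi : i ∉ (univ : Finset (Fin n)).erase i := by simp
  have hcongr : ∀ m, esymmOn (μ + t • Pi.single i 1) (univ.erase i) m =
      esymmOn μ (univ.erase i) m := by
    intro m
    refine sum_congr rfl fun u hu => prod_congr rfl fun j hj => ?_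
    have : j ≠ i := ne_of_mem_erase ((mem_powersetCard.1 hu).1 hj)
    simp [this]
  have hcongr' : esymmOnDeriv (μ + t • Pi.single i 1) (univ.erase i) m =
      esymmOnDeriv μ (univ.erase i) m := by
    cases m with
    | zero => rfl
    | succ m => exact hcongr m
  simp only [← esymmOn_univ]
  rw [← insert_erase (mem_univ i), esymmOn_insert hi, esymmOn_insert hi, hcongr, hcongr']
  simp
  ring

theorem fderiv_esymm_single (m : ℕ) (μ : Fin n → ℝ) (i : Fin n) :
    fderiv ℝ (esymm n m) μ (Pi.single i 1) = esymmOnDeriv μ (univ.erase i) m := by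
  rw [← (differentiable_esymm m μ).lineDeriv_eq_fderiv, lineDeriv]
  simp only [esymm_add_smul_single]
  simp

theorem Gii_eq {k l : ℕ} {μ : Fin n → ℝ} (hk : 0 < esymm n k μ) (hl : 0 < esymm n l μ)
    (i : Fin n) :
    Gii n k l μ i = ((k : ℝ) - l)⁻¹ * (esymm n k μ / esymm n l μ) ^ (((k : ℝ) - l)⁻¹ - 1) /
        esymm n l μ ^ 2 *
      (esymmOnDeriv μ (univ.erase i) k * esymm n l μ -
        esymm n k μ * esymmOnDeriv μ (univ.erase i) l) := by
  have hinv := (hasDerivAt_inv hl.ne').comp_hasFDerivAt μ (differentiable_esymm l μ).hasFDerivAt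
  have h := ((differentiable_esymm k μ).hasFDerivAt.mul hinv).rpow_const
    (p := ((k : ℝ) - l)⁻¹) (Or.inl (mul_pos hk (inv_pos.2 hl)).ne')
  have hG : HasFDerivAt (Gq n k l) _ μ := h
  rw [Gii, hG.fderiv]
  simp only [Function.comp_apply, Pi.mul_apply, _root_.smul_apply,
    _root_.add_apply, fderiv_esymm_single, smul_eq_mul, ← div_eq_mul_inv]
  field_simp
  ring

end Derivative

theorem stmt_1 (n k l : ℕ) (hk : 2 ≤ k) (hkn : k ≤ n) (hl : l + 2 ≤ k)
    (μ : Fin n → ℝ) (hmono : Monotone μ)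
    (hΓ : ∀ j, 1 ≤ j → j ≤ k → 0 < esymm n j μ) :
    (∀ i j : Fin n, i ≤ j → Gii n k l μ j ≤ Gii n k l μ i) ∧
      (∀ i : Fin n, 0 ≤ Gii n k l μ i) := by
  have hpos : ∀ m ≤ k, 0 < esymmOn μ univ m := by
    intro m hm
    rcases Nat.eq_zero_or_pos m with rfl | h
    · simp
    · exact hΓ m h hm
  have hk0 : 0 < esymm n k μ := hpos k le_rfl
  have hl0 : 0 < esymm n l μ := hpos l (by omega)
  have hkl : (0 : ℝ) < (k : ℝ) - l := by
    rw [sub_pos]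
    exact_mod_cast (show l < k by omega)
  have hc : 0 ≤ ((k : ℝ) - l)⁻¹ * (esymm n k μ / esymm n l μ) ^ (((k : ℝ) - l)⁻¹ - 1) /
      esymm n l μ ^ 2 := by positivity
  refine ⟨fun i j hij => ?_, fun i => ?_⟩
  · rcases eq_or_ne i j with rfl | hne
    · exact le_rfl
    rw [Gii_eq hk0 hl0, Gii_eq hk0 hl0]
    refine mul_le_mul_of_nonneg_left ?_ hc
    set s : Finset (Fin n) := (univ.erase i).erase j with hs
    have hj : insert j s = univ.erase i := insert_erase (by simp [hne.symm])
    have hi : insert i s = univ.erase j := by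
      rw [hs, erase_right_comm]
      exact insert_erase (by simp [hne])
    have hu : insert i (insert j s) = univ := by rw [hj, insert_erase (mem_univ i)]
    have := esymmOnDeriv_quotient_le (μ := μ) (s := s) (k := k) hne (by simp [hs]) (by simp [hs])
      (by rwa [hu]) hl (hmono hij)
    rwa [hu, hi, hj, esymmOn_univ, esymmOn_univ] at this
  · rw [Gii_eq hk0 hl0]
    refine mul_nonneg hc ?_
    have := esymmOnDeriv_quotient_nonneg (μ := μ) (k := k) (l := l) (notMem_erase i univ)
      (by rwa [insert_erase (mem_univ i)]) (by omega)
    rwa [insert_erase (mem_univ i), esymmOn_univ, esymmOn_univ] at this
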